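/- Fix γ > 0 and suppose SMdim_γ(H) = d < ∞. Then there exists a prediction strategy A, assigning to every round t ≥ 1, every history ((x_1,y_1,ε_1),…,(x_{t-1},y_{t-1},ε_{t-1})) ∈ (X×Y×[0,c])^{t-1}, and every instance x_t ∈ X a probability measure μ_t ∈ Π(Z), such that for every horizon T ∈ ℕ and every ε_t-realizable stream (x_1,(y_1,ε_1)),…,(x_T,(y_T,ε_T)) — i.e., there exists h* ∈ H with ℓ(y_t, h*(x_t)) ≤ ε_t for all t ∈ {1,…,T} — the expected cumulative loss satisfies Σ_{t=1}^T E_{z∼μ_t}[ℓ(y_t, z)] ≤ Σ_{t=1}^T ε_t + γ·T + c·d, where μ_t is the measure output by A on the history ((x_i,y_i,ε_i))_{i<t} and instance x_t. -/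

import Mathlib

open MeasureTheory

/-- `H` γ-shatters an SMdim tree of depth `d` with respect to the loss `ℓ`. -/
def SMShatter {X Y Z : Type*} [MeasurableSpace Z] (H : Set (X → Z)) (ℓ : Y → Z → ℝ)
    (γ : ℝ) (d : ℕ) : Prop :=
  ∃ (Tt : (t : Fin d) → (Fin t.1 → ProbabilityMeasure Z) → X)
    (f : (t : Fin d) → (Fin (t.1 + 1) → ProbabilityMeasure Z) → Y),
    ∀ μ : Fin d → ProbabilityMeasure Z, ∃ h ∈ H, ∀ t : Fin d,
      ℓ (f t fun i => μ (Fin.castLE t.isLt i))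
          (h (Tt t fun i => μ (Fin.castLE t.isLt.le i))) + γ ≤
        ∫ z, ℓ (f t fun i => μ (Fin.castLE t.isLt i)) z ∂(μ t : Measure Z)

/-- The sequential Minimax dimension of `H` at scale `γ`, as an extended natural number. -/
noncomputable def SMdim {X Y Z : Type*} [MeasurableSpace Z] (H : Set (X → Z))
    (ℓ : Y → Z → ℝ) (γ : ℝ) : ℕ∞ :=
  sSup {n : ℕ∞ | ∃ d : ℕ, n = (d : ℕ∞) ∧ SMShatter H ℓ γ d}

section Shattering

variable {X Y Z : Type*} [MeasurableSpace Z] {ℓ : Y → Z → ℝ} {γ : ℝ}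

theorem SMShatter.mono {V W : Set (X → Z)} {n : ℕ} (h : SMShatter V ℓ γ n) (hVW : V ⊆ W) :
    SMShatter W ℓ γ n := by
  obtain ⟨Tt, f, hf⟩ := h
  refine ⟨Tt, f, fun μ => ?_⟩
  obtain ⟨g, hg, hgt⟩ := hf μ
  exact ⟨g, hVW hg, hgt⟩

theorem smShatter_zero {V : Set (X → Z)} (hV : V.Nonempty) : SMShatter V ℓ γ 0 := by
  obtain ⟨g, hg⟩ := hV
  exact ⟨fun t => t.elim0, fun t => t.elim0, fun _ => ⟨g, hg, fun t => t.elim0⟩⟩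

/-- A tree of depth `n + 1` is a root instance together with, for every measure at the root, a label
and a tree of depth `n` for the hypotheses satisfying the root constraint. -/
theorem SMShatter.succ {V : Set (X → Z)} {n : ℕ} (x : X)
    (h : ∀ μ : ProbabilityMeasure Z, ∃ y : Y,
      SMShatter {g ∈ V | ℓ y (g x) + γ ≤ ∫ z, ℓ y z ∂(μ : Measure Z)} ℓ γ n) :
    SMShatter V ℓ γ (n + 1) := by
  choose y T' f' h' using h
  refine ⟨Fin.cases (fun _ => x) (fun t ν => T' (ν (0 : Fin (t.1 + 1))) t (fun i => ν i.succ)),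
    Fin.cases (fun ν => y (ν 0))
      (fun t ν => f' (ν (0 : Fin (t.1 + 1 + 1))) t (fun i => ν i.succ)), fun μ => ?_⟩
  obtain ⟨g, ⟨hgV, hg0⟩, hg⟩ := h' (μ 0) (fun i => μ i.succ)
  exact ⟨g, hgV, Fin.cases hg0 hg⟩

theorem exists_measure_of_not_smShatter_succ {V : Set (X → Z)} {n : ℕ}
    (h : ¬ SMShatter V ℓ γ (n + 1)) (x : X) :
    ∃ μ : ProbabilityMeasure Z, ∀ (y : Y) (ε : ℝ),
      ∫ z, ℓ y z ∂(μ : Measure Z) ≤ ε + γ ∨ ¬ SMShatter {g ∈ V | ℓ y (g x) ≤ ε} ℓ γ n := by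
  by_contra! hcon
  refine h (SMShatter.succ x fun μ => ?_)
  obtain ⟨y, ε, hlt, hs⟩ := hcon μ
  exact ⟨y, hs.mono fun g hg => ⟨hg.1, by linarith [hg.2]⟩⟩

theorem not_smShatter_succ_of_smdim_eq {H : Set (X → Z)} {d : ℕ}
    (h : SMdim H ℓ γ = (d : ℕ∞)) : ¬ SMShatter H ℓ γ (d + 1) := by
  intro hs
  have hle : ((d + 1 : ℕ) : ℕ∞) ≤ SMdim H ℓ γ := le_sSup ⟨d + 1, rfl, hs⟩
  rw [h, Nat.cast_le] at hle
  omega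

/-- The least depth that is not shattered by `V` (and `0` if all depths are shattered). -/
noncomputable def leastUnshattered (ℓ : Y → Z → ℝ) (γ : ℝ) (V : Set (X → Z)) : ℕ :=
  sInf {n | ¬ SMShatter V ℓ γ n}

theorem leastUnshattered_le {V : Set (X → Z)} {n : ℕ} (h : ¬ SMShatter V ℓ γ n) :
    leastUnshattered ℓ γ V ≤ n :=
  Nat.sInf_le h

theorem not_smShatter_leastUnshattered {V : Set (X → Z)} {n : ℕ} (h : ¬ SMShatter V ℓ γ n) :
    ¬ SMShatter V ℓ γ (leastUnshattered ℓ γ V) :=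
  Nat.sInf_mem (s := {n | ¬ SMShatter V ℓ γ n}) ⟨n, h⟩

theorem leastUnshattered_pos {V : Set (X → Z)} {n : ℕ} (h : ¬ SMShatter V ℓ γ n)
    (hV : V.Nonempty) : 0 < leastUnshattered ℓ γ V :=
  Nat.pos_of_ne_zero fun h0 => not_smShatter_leastUnshattered h (h0 ▸ smShatter_zero hV)

/-- One prediction step: the excess loss is paid for by a drop of `leastUnshattered`. -/
theorem exists_measure_integral_le {c : ℝ} (hc : 0 ≤ c) (hγ : 0 ≤ γ)
    (hℓc : ∀ y z, ℓ y z ≤ c) (hℓ0 : ∀ y z, 0 ≤ ℓ y z) {V : Set (X → Z)} {n : ℕ}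
    (h : ¬ SMShatter V ℓ γ n) (hV : V.Nonempty) (x : X) :
    ∃ μ : ProbabilityMeasure Z, ∀ (y : Y) (ε : ℝ), 0 ≤ ε →
      ∫ z, ℓ y z ∂(μ : Measure Z) ≤ ε + γ + c * (leastUnshattered ℓ γ V -
        leastUnshattered ℓ γ {g ∈ V | ℓ y (g x) ≤ ε}) := by
  obtain ⟨k, hk⟩ := Nat.exists_eq_succ_of_ne_zero (leastUnshattered_pos h hV).ne'
  have hns := not_smShatter_leastUnshattered h
  rw [hk] at hns
  obtain ⟨μ, hμ⟩ := exists_measure_of_not_smShatter_succ hns x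
  refine ⟨μ, fun y ε hε => ?_⟩
  rcases hμ y ε with hle | hdrop
  · have hmono : leastUnshattered ℓ γ {g ∈ V | ℓ y (g x) ≤ ε} ≤ leastUnshattered ℓ γ V :=
      leastUnshattered_le fun hs =>
        not_smShatter_leastUnshattered h (hs.mono fun g hg => hg.1)
    have hmono' : (leastUnshattered ℓ γ {g ∈ V | ℓ y (g x) ≤ ε} : ℝ) ≤
        leastUnshattered ℓ γ V := by exact_mod_cast hmono
    nlinarith
  · have hlt : leastUnshattered ℓ γ {g ∈ V | ℓ y (g x) ≤ ε} + 1 ≤ leastUnshattered ℓ γ V := by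
      have := leastUnshattered_le hdrop
      omega
    have hlt' : (leastUnshattered ℓ γ {g ∈ V | ℓ y (g x) ≤ ε} : ℝ) + 1 ≤
        leastUnshattered ℓ γ V := by exact_mod_cast hlt
    have hint : ∫ z, ℓ y z ∂(μ : Measure Z) ≤ c := by
      calc ∫ z, ℓ y z ∂(μ : Measure Z) ≤ ∫ _, c ∂(μ : Measure Z) :=
            integral_mono_of_nonneg (.of_forall (hℓ0 y)) (integrable_const c)
              (.of_forall (hℓc y))
        _ = c := by simp
    nlinarith

end Shattering

/-- The hypotheses of `H` consistent with a history of instances, labels and tolerances. -/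
def versionSpace {X Y Z : Type*} (ℓ : Y → Z → ℝ) (H : Set (X → Z)) (p : List (X × Y × ℝ)) :
    Set (X → Z) :=
  {g ∈ H | ∀ q ∈ p, ℓ q.2.1 (g q.1) ≤ q.2.2}

theorem versionSpace_append_singleton {X Y Z : Type*} (ℓ : Y → Z → ℝ) (H : Set (X → Z))
    (p : List (X × Y × ℝ)) (q : X × Y × ℝ) :
    versionSpace ℓ H (p ++ [q]) = {g ∈ versionSpace ℓ H p | ℓ q.2.1 (g q.1) ≤ q.2.2} := by
  ext g
  simp [versionSpace, or_imp, forall_and, and_assoc]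

/-- if `SMdim_γ(H) = d < ∞`, there is a prediction strategy whose expected
cumulative loss on any `ε_t`-realizable stream is at most `Σ ε_t + γ·T + c·d`. -/
theorem statement1 {X Y Z : Type*} [MeasurableSpace Z] [Nonempty X] [Nonempty Y]
    (ℓ : Y → Z → ℝ) (c : ℝ) (hc : 0 < c)
    (hℓ0 : ∀ y z, 0 ≤ ℓ y z) (hℓc : ∀ y z, ℓ y z ≤ c)
    (hmeas : ∀ y, Measurable (ℓ y))
    (H : Set (X → Z)) (hH : H.Nonempty)
    (γ : ℝ) (hγ : 0 < γ) (d : ℕ) (hdim : SMdim H ℓ γ = (d : ℕ∞)) :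
    ∃ A : List (X × Y × ℝ) → X → ProbabilityMeasure Z,
      ∀ (T : ℕ) (x : Fin T → X) (y : Fin T → Y) (ε : Fin T → ℝ),
        (∀ t, ε t ∈ Set.Icc 0 c) →
        (∃ hstar ∈ H, ∀ t, ℓ (y t) (hstar (x t)) ≤ ε t) →
        (∑ t : Fin T, ∫ z, ℓ (y t) z
            ∂(A ((List.ofFn fun i : Fin T => (x i, y i, ε i)).take t.1) (x t) : Measure Z)) ≤
          (∑ t : Fin T, ε t) + γ * T + c * d := by
  have hns : ∀ p, ¬ SMShatter (versionSpace ℓ H p) ℓ γ (d + 1) := fun p hs =>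
    not_smShatter_succ_of_smdim_eq hdim (hs.mono fun g hg => hg.1)
  have hZ : Nonempty (ProbabilityMeasure Z) := by
    obtain ⟨g, -⟩ := hH
    exact ⟨⟨Measure.dirac (g (Classical.arbitrary X)), inferInstance⟩⟩
  have hstep : ∀ (p : List (X × Y × ℝ)) (x : X), ∃ μ : ProbabilityMeasure Z,
      (versionSpace ℓ H p).Nonempty → ∀ (y : Y) (ε : ℝ), 0 ≤ ε →
        ∫ z, ℓ y z ∂(μ : Measure Z) ≤ ε + γ + c * (leastUnshattered ℓ γ (versionSpace ℓ H p) -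
          leastUnshattered ℓ γ (versionSpace ℓ H (p ++ [(x, y, ε)]))) := by
    intro p x
    by_cases hV : (versionSpace ℓ H p).Nonempty
    · obtain ⟨μ, hμ⟩ := exists_measure_integral_le hc.le hγ.le hℓc hℓ0 (hns p) hV x
      refine ⟨μ, fun _ y ε hε => ?_⟩
      rw [versionSpace_append_singleton]
      exact hμ y ε hε
    · exact ⟨hZ.some, fun h => absurd h hV⟩
  choose A hA using hstep
  refine ⟨A, fun T x y ε hε ⟨g, hgH, hg⟩ => ?_⟩
  set L := List.ofFn fun i : Fin T => (x i, y i, ε i) with hL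
  have hmem : ∀ t, g ∈ versionSpace ℓ H (L.take t) := by
    refine fun t => ⟨hgH, fun q hq => ?_⟩
    obtain ⟨i, rfl⟩ := List.mem_ofFn.1 (List.mem_of_mem_take hq)
    exact hg i
  set Φ : ℕ → ℝ := fun t => leastUnshattered ℓ γ (versionSpace ℓ H (L.take t)) with hΦ
  have hround : ∀ t : Fin T, ∫ z, ℓ (y t) z ∂(A (L.take t.1) (x t) : Measure Z) ≤
      ε t + γ + c * (Φ t.1 - Φ (t.1 + 1)) := by
    intro t
    have hlen : t.1 < L.length := by simp [hL]
    have htake : L.take (t.1 + 1) = L.take t.1 ++ [(x t, y t, ε t)] := by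
      rw [List.take_succ_eq_append_getElem hlen]
      simp [hL]
    simp only [hΦ, htake]
    exact hA _ _ ⟨g, hmem _⟩ _ _ (hε t).1
  have htel : ∑ t : Fin T, (Φ t.1 - Φ (t.1 + 1)) = Φ 0 - Φ T := by
    rw [Fin.sum_univ_eq_sum_range (fun t => Φ t - Φ (t + 1)), Finset.sum_range_sub']
  have hΦ0 : Φ 0 ≤ d + 1 := by
    simp only [hΦ]
    exact_mod_cast leastUnshattered_le (hns _)
  have hΦT : 1 ≤ Φ T := by
    simp only [hΦ]
    exact_mod_cast Nat.succ_le_of_lt (leastUnshattered_pos (hns _) ⟨g, hmem T⟩)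
  calc ∑ t : Fin T, ∫ z, ℓ (y t) z ∂(A (L.take t.1) (x t) : Measure Z)
      ≤ ∑ t : Fin T, (ε t + γ + c * (Φ t.1 - Φ (t.1 + 1))) :=
        Finset.sum_le_sum fun t _ => hround t
    _ = ∑ t : Fin T, ε t + γ * T + c * (Φ 0 - Φ T) := by
        rw [Finset.sum_add_distrib, Finset.sum_add_distrib, ← Finset.mul_sum, htel]
        simp [mul_comm]
    _ ≤ ∑ t : Fin T, ε t + γ * T + c * d := by
        gcongr
        linarith
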